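/- Let P ∈ ℂ[x,y,z] be a homogeneous polynomial of degree n ≥ 2 whose degree in y equals n. Put D(x,z,t) := Res_y(P(x,y,z) − t, ∂P/∂y(x,y,z)) ∈ ℂ[x,z,t], and set D_∞(x,t) := D(x,1,t) ∈ ℂ[x,t] and D_0(z,t) := D(1,z,t) ∈ ℂ[z,t]. Let L : ℤ² → ℤ² be the affine map L(i,k) = (n(n−1) − i − n·k, k). Then supp D_0 = L(supp D_∞), where supp D_∞ ⊆ ℕ² is the set of exponent pairs (i,k) of monomials x^i t^k occurring in D_∞, and supp D_0 the set of exponent pairs (j,k) of monomials z^j t^k occurring in D_0. -/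

import Mathlib

open Pointwise

noncomputable section
set_option synthInstance.maxHeartbeats 1000000

/-- The Sylvester matrix of `P` and `Q` with respect to the degree bounds `n` and `m`. -/
def sylvester {R : Type*} [CommRing R] (P Q : Polynomial R) (n m : ℕ) :
    Matrix (Fin (m + n)) (Fin (m + n)) R :=
  Matrix.of fun i j =>
    if (i : ℕ) < m then
      (if (i : ℕ) ≤ (j : ℕ) then P.coeff ((j : ℕ) - (i : ℕ)) else 0)
    else
      (if (i : ℕ) - m ≤ (j : ℕ) then Q.coeff ((j : ℕ) - ((i : ℕ) - m)) else 0)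

/-- The resultant of two polynomials: the determinant of their Sylvester matrix. -/
def resultant {R : Type*} [CommRing R] (P Q : Polynomial R) : R :=
  (sylvester P Q P.natDegree Q.natDegree).det

/-- For `P ∈ ℂ[x,z][y]` (a trivariate polynomial viewed as a polynomial in `y`
with coefficients in `ℂ[x,z]`), the discriminant
`D(x,z,t) = Res_y (P(x,y,z) - t, ∂P/∂y (x,y,z)) ∈ ℂ[x,z,t]`,
where the variables of `Fin 3` are `x, z, t` in this order. -/
def discrimHom (P : Polynomial (MvPolynomial (Fin 2) ℂ)) : MvPolynomial (Fin 3) ℂ :=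
  resultant
    (P.map (MvPolynomial.rename (Fin.castSucc : Fin 2 → Fin 3)
        : MvPolynomial (Fin 2) ℂ →ₐ[ℂ] MvPolynomial (Fin 3) ℂ).toRingHom
      - Polynomial.C (MvPolynomial.X 2))
    ((Polynomial.derivative P).map
      (MvPolynomial.rename (Fin.castSucc : Fin 2 → Fin 3)
        : MvPolynomial (Fin 2) ℂ →ₐ[ℂ] MvPolynomial (Fin 3) ℂ).toRingHom)

/-- The support of a polynomial in `ℂ[x,t]` as a set of pairs in `ℤ²`. -/
def suppZ (q : MvPolynomial (Fin 2) ℂ) : Set (ℤ × ℤ) :=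
  {pr : ℤ × ℤ | ∃ i k : ℕ,
    MvPolynomial.coeff (Finsupp.single (0 : Fin 2) i + Finsupp.single (1 : Fin 2) k) q ≠ 0
      ∧ pr = ((i : ℤ), (k : ℤ))}

namespace MvPolynomial

variable {R M σ τ : Type*} [CommRing R]

theorem IsWeightedHomogeneous.det [AddCommGroup M] {w : σ → M} {ι : Type*} [Fintype ι]
    [DecidableEq ι] {A : Matrix ι ι (MvPolynomial σ R)} {r c : ι → M}
    (hA : ∀ i j, (A i j).IsWeightedHomogeneous w (r i - c j)) :
    A.det.IsWeightedHomogeneous w (∑ i, r i - ∑ j, c j) := by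
  rw [Matrix.det_apply', ← mem_weightedHomogeneousSubmodule]
  refine Submodule.sum_mem _ fun g _ => ?_
  rw [mem_weightedHomogeneousSubmodule]
  have h := IsWeightedHomogeneous.prod (w := w) Finset.univ (fun i => A (g i) i)
    (fun i => r (g i) - c i) fun i _ => hA _ _
  rw [Finset.sum_sub_distrib, Equiv.sum_comp g r] at h
  simpa only [map_intCast] using h.C_mul ((Equiv.Perm.sign g : ℤ) : R)

theorem IsHomogeneous.rename_isWeightedHomogeneous {f : σ → τ}
    {w : τ → ℤ} (hw : ∀ i, w (f i) = 1) {φ : MvPolynomial σ R} {d : ℕ} (hφ : φ.IsHomogeneous d) :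
    (rename f φ).IsWeightedHomogeneous w (d : ℤ) := by
  intro e he
  obtain ⟨u, rfl, hu⟩ := coeff_rename_ne_zero f φ e he
  rw [← hφ hu, Finsupp.weight_apply, Finsupp.weight_apply,
    Finsupp.sum_mapDomain_index (by simp) (by intros; simp [add_mul])]
  simp [hw, Finsupp.sum]

theorem coeff_sum_monomial_ne_zero_iff {q : MvPolynomial σ R} {f : (σ →₀ ℕ) → (τ →₀ ℕ)}
    (hf : Set.InjOn f q.support) (e : τ →₀ ℕ) :
    coeff e (∑ d ∈ q.support, monomial (f d) (coeff d q)) ≠ 0 ↔ ∃ d ∈ q.support, f d = e := by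
  classical
  simp only [coeff_sum, coeff_monomial]
  constructor
  · intro h
    obtain ⟨d, hd, h⟩ := Finset.exists_ne_zero_of_sum_ne_zero h
    exact ⟨d, hd, by by_contra hne; simp [hne] at h⟩
  · rintro ⟨d, hd, rfl⟩
    rw [Finset.sum_eq_single_of_mem d hd fun b hb hbd => if_neg fun h => hbd (hf hb hd h)]
    simpa using hd

end MvPolynomial

open MvPolynomial in
theorem sylvester_det_isWeightedHomogeneous {R σ : Type*} [CommRing R] {w : σ → ℤ}
    {P Q : Polynomial (MvPolynomial σ R)} {a b : ℤ} (n m : ℕ)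
    (hP : ∀ k, (P.coeff k).IsWeightedHomogeneous w (a - k))
    (hQ : ∀ k, (Q.coeff k).IsWeightedHomogeneous w (b - k)) :
    (sylvester P Q n m).det.IsWeightedHomogeneous w (m * a + n * (b - m)) := by
  have h := IsWeightedHomogeneous.det (w := w) (A := sylvester P Q n m)
    (r := fun i => (if (i : ℕ) < m then a else b - m) + i) (c := fun j => (j : ℤ)) ?_
  · have hsum : ∑ i : Fin (m + n), ((if (i : ℕ) < m then a else b - m) + (i : ℤ)) -
        ∑ j : Fin (m + n), (j : ℤ) = m * a + n * (b - m) := by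
      rw [Finset.sum_add_distrib, add_sub_cancel_right, Fin.sum_univ_add]
      simp [mul_sub]
    rwa [hsum] at h
  · intro i j
    simp only [sylvester, Matrix.of_apply]
    split_ifs with h₁ h₂ h₂
    · have h := hP (j - i)
      rw [Nat.cast_sub h₂] at h
      rwa [show a + (i : ℤ) - j = a - (j - i) by ring]
    · exact isWeightedHomogeneous_zero _ _ _
    · have h := hQ (j - (i - m))
      rw [Nat.cast_sub h₂, Nat.cast_sub (not_lt.mp h₁)] at h
      rwa [show b - m + (i : ℤ) - j = b - (j - (i - m)) by ring]
    · exact isWeightedHomogeneous_zero _ _ _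

open MvPolynomial in
theorem discrimHom_isWeightedHomogeneous {n : ℕ} (hn : 1 ≤ n)
    {P : Polynomial (MvPolynomial (Fin 2) ℂ)} (hdegy : P.natDegree = n)
    (hhom : ∀ j, j ≤ n → (P.coeff j).IsHomogeneous (n - j)) :
    (discrimHom P).IsWeightedHomogeneous ![1, 1, (n : ℤ)] ((n * (n - 1) : ℕ) : ℤ) := by
  have hinj : Function.Injective (Fin.castSucc : Fin 2 → Fin 3) := Fin.castSucc_injective 2
  have hw : ∀ i : Fin 2, ![1, 1, (n : ℤ)] (Fin.castSucc i) = 1 := by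
    intro i; fin_cases i <;> rfl
  have hcoeff : ∀ k, (rename (Fin.castSucc : Fin 2 → Fin 3) (P.coeff k)).IsWeightedHomogeneous
      ![1, 1, (n : ℤ)] ((n : ℤ) - k) := by
    intro k
    rcases le_or_gt k n with hk | hk
    · simpa [hk] using (hhom k hk).rename_isWeightedHomogeneous hw
    · rw [Polynomial.coeff_eq_zero_of_natDegree_lt (hdegy ▸ hk), map_zero]
      exact isWeightedHomogeneous_zero _ _ _
  have hinj' : Function.Injective (rename (Fin.castSucc : Fin 2 → Fin 3)
      : MvPolynomial (Fin 2) ℂ →ₐ[ℂ] MvPolynomial (Fin 3) ℂ).toRingHom := rename_injective _ hinj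
  rw [discrimHom, resultant, Polynomial.natDegree_sub_C,
    Polynomial.natDegree_map_eq_of_injective hinj', Polynomial.natDegree_map_eq_of_injective hinj',
    Polynomial.natDegree_derivative, hdegy]
  have hdeg : ((n * (n - 1) : ℕ) : ℤ) =
      (n - 1 : ℕ) * (n : ℤ) + n * ((n : ℤ) - 1 - (n - 1 : ℕ)) := by
    push_cast [hn]
    ring
  rw [hdeg]
  refine sylvester_det_isWeightedHomogeneous n (n - 1) ?_ ?_
  · intro k
    rw [Polynomial.coeff_sub, Polynomial.coeff_map, Polynomial.coeff_C]
    refine (hcoeff k).sub ?_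
    split_ifs with hk
    · simpa [hk] using isWeightedHomogeneous_X ℂ ![1, 1, (n : ℤ)] (2 : Fin 3)
    · exact isWeightedHomogeneous_zero _ _ _
  · intro k
    rw [Polynomial.coeff_map, Polynomial.coeff_derivative]
    have h := (hcoeff (k + 1)).C_mul ((k : ℂ) + 1)
    rw [show (n : ℤ) - (k + 1 : ℕ) = n - 1 - k by push_cast; ring] at h
    simpa [mul_comm] using h

open MvPolynomial in
theorem suppZ_aeval_eq {q : MvPolynomial (Fin 3) ℂ} {v : Fin 3 → MvPolynomial (Fin 2) ℂ}
    {a : Fin 3}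
    (hv : ∀ d : Fin 3 →₀ ℕ, d.prod (fun i k => v i ^ k) =
      monomial (Finsupp.single 0 (d a) + Finsupp.single 1 (d 2)) 1)
    (hq : ∀ d ∈ q.support, ∀ e ∈ q.support, d a = e a → d 2 = e 2 → d = e) :
    suppZ (aeval v q) = (fun d : Fin 3 →₀ ℕ => ((d a : ℤ), (d 2 : ℤ))) '' q.support := by
  have hsingle : ∀ i k i' k' : ℕ, (Finsupp.single (0 : Fin 2) i + Finsupp.single 1 k =
      Finsupp.single 0 i' + Finsupp.single 1 k') ↔ i = i' ∧ k = k' := by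
    simp [Finsupp.ext_iff, Fin.forall_fin_two]
  have haeval : aeval v q = ∑ d ∈ q.support,
      monomial (Finsupp.single (0 : Fin 2) (d a) + Finsupp.single 1 (d 2)) (coeff d q) := by
    conv_lhs => rw [q.as_sum, map_sum]
    refine Finset.sum_congr rfl fun d _ => ?_
    rw [aeval_monomial, hv, algebraMap_eq, C_mul_monomial, mul_one]
  ext pr
  simp only [suppZ, haeval, Set.mem_ofPred_eq, Set.mem_image]
  constructor
  · rintro ⟨i, k, h, rfl⟩
    rw [coeff_sum_monomial_ne_zero_iff] at h
    · obtain ⟨d, hd, h⟩ := h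
      obtain ⟨rfl, rfl⟩ := (hsingle _ _ _ _).mp h
      exact ⟨d, hd, rfl⟩
    · exact fun d hd e he h => hq d hd e he ((hsingle _ _ _ _).mp h).1 ((hsingle _ _ _ _).mp h).2
  · rintro ⟨d, hd, rfl⟩
    refine ⟨d a, d 2, (coeff_sum_monomial_ne_zero_iff ?_ _).mpr ⟨d, hd, rfl⟩, rfl⟩
    exact fun d hd e he h => hq d hd e he ((hsingle _ _ _ _).mp h).1 ((hsingle _ _ _ _).mp h).2

/-- **Lemma (supports of the discriminant at zero and at infinity).**
With `D = Res_y(P - t, ∂P/∂y)`, `D_∞(x,t) = D(x,1,t)`, `D_0(z,t) = D(1,z,t)` and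
`L(i,k) = (n(n-1) - i - nk, k)`, one has `supp D_0 = L(supp D_∞)`. -/
theorem supp_discr_zero_eq_image_supp_discr_infinity
    (n : ℕ) (hn : 2 ≤ n) (P : Polynomial (MvPolynomial (Fin 2) ℂ))
    (hdegy : P.natDegree = n) (hlead : P.coeff n ≠ 0)
    (hhom : ∀ j, j ≤ n → (P.coeff j).IsHomogeneous (n - j)) :
    suppZ (MvPolynomial.aeval ![1, MvPolynomial.X 0, MvPolynomial.X 1] (discrimHom P))
      = (fun pr : ℤ × ℤ => (((n * (n - 1) : ℕ) : ℤ) - pr.1 - (n : ℤ) * pr.2, pr.2)) ''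
        suppZ (MvPolynomial.aeval ![MvPolynomial.X 0, 1, MvPolynomial.X 1]
          (discrimHom P)) := by
  have hsum : ∀ d ∈ (discrimHom P).support,
      (d 0 : ℤ) + d 1 + n * d 2 = ((n * (n - 1) : ℕ) : ℤ) := by
    intro d hd
    rw [← discrimHom_isWeightedHomogeneous (by omega) hdegy hhom (MvPolynomial.mem_support_iff.mp hd),
      Finsupp.weight_apply, Finsupp.sum_fintype _ _ (by simp)]
    simp [Fin.sum_univ_three, mul_comm]
  have hext : ∀ d e : Fin 3 →₀ ℕ, d 0 = e 0 → d 1 = e 1 → d 2 = e 2 → d = e := by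
    intro d e h₀ h₁ h₂
    ext i
    fin_cases i <;> assumption
  rw [suppZ_aeval_eq (a := 1), suppZ_aeval_eq (a := 0), Set.image_image]
  · refine Set.image_congr fun d hd => Prod.ext ?_ rfl
    linarith [hsum d hd]
  · intro d
    rw [Finsupp.prod_fintype _ _ (by simp), Fin.prod_univ_three]
    simp [MvPolynomial.X_pow_eq_monomial, MvPolynomial.monomial_mul]
  · intro d hd e he h₀ h₂
    have hd' := hsum d hd
    rw [h₀, h₂] at hd'
    exact hext d e h₀ (by linarith [hsum e he]) h₂
  · intro d
    rw [Finsupp.prod_fintype _ _ (by simp), Fin.prod_univ_three]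
    simp [MvPolynomial.X_pow_eq_monomial, MvPolynomial.monomial_mul]
  · intro d hd e he h₁ h₂
    have hd' := hsum d hd
    rw [h₁, h₂] at hd'
    exact hext d e (by linarith [hsum e he]) h₁ h₂

end
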